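/- arXiv:math/0008187 — 3 statements merged into one kernel-verified Lean document; each statement's English description precedes it below -/
import Mathlib

section
/- For every integer n ≥ 2, every element of the Kauffman monoid K_n is equal in K_n to an element of the form c^l h^{[b_1,a_1]} ⋯ h^{[b_k,a_k]}, where l ≥ 0, k ≥ 0, 1 ≤ a_t ≤ b_t ≤ n−1 for each t, a_1 < … < a_k and b_1 < … < b_k (the case l = k = 0 giving the unit 1). -/
/-!
Kauffman monoid `K n` for `n ≥ 2`: presented by generators `h^1, …, h^{n-1}`
(diapsides) and `c` (circle), subject to
`h^i h^j = h^j h^i` for `|i-j| ≥ 2`, `h^i h^{i±1} h^i = h^i`,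
`h^i c = c h^i`, `h^i h^i = c h^i`.
-/

namespace Kauffman

/-- Valid diapsis indices `1 ≤ i ≤ n-1`. -/
def Idx (n : ℕ) : Type := {i : ℕ // 1 ≤ i ∧ i ≤ n - 1}

/-- Generators of the Kauffman monoid. -/
inductive Gen (n : ℕ) : Type
  | h : Idx n → Gen n
  | c : Gen n

/-- The defining relations of the Kauffman monoid. -/
inductive Rel (n : ℕ) : FreeMonoid (Gen n) → FreeMonoid (Gen n) → Prop
  | comm (i j : Idx n) (hij : i.1 + 2 ≤ j.1 ∨ j.1 + 2 ≤ i.1) :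
      Rel n (FreeMonoid.of (Gen.h i) * FreeMonoid.of (Gen.h j))
            (FreeMonoid.of (Gen.h j) * FreeMonoid.of (Gen.h i))
  | absorb (i j : Idx n) (hij : j.1 = i.1 + 1 ∨ i.1 = j.1 + 1) :
      Rel n (FreeMonoid.of (Gen.h i) * FreeMonoid.of (Gen.h j) * FreeMonoid.of (Gen.h i))
            (FreeMonoid.of (Gen.h i))
  | hc (i : Idx n) :
      Rel n (FreeMonoid.of (Gen.h i) * FreeMonoid.of Gen.c)
            (FreeMonoid.of Gen.c * FreeMonoid.of (Gen.h i))
  | hh (i : Idx n) :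
      Rel n (FreeMonoid.of (Gen.h i) * FreeMonoid.of (Gen.h i))
            (FreeMonoid.of Gen.c * FreeMonoid.of (Gen.h i))

/-- The congruence generated by the Kauffman relations. -/
def kcon (n : ℕ) : Con (FreeMonoid (Gen n)) := conGen (Rel n)

/-- The Kauffman monoid `K n`. -/
abbrev K (n : ℕ) : Type := (kcon n).Quotient

/-- The diapsis `h^i` as an element of `K n` (defined to be `1` for out-of-range `i`). -/
def hK (n i : ℕ) : K n :=
  if h : 1 ≤ i ∧ i ≤ n - 1 then ((FreeMonoid.of (Gen.h ⟨i, h⟩) : FreeMonoid (Gen n)) : K n)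
  else 1

/-- The circle `c` as an element of `K n`. -/
def cK (n : ℕ) : K n := ((FreeMonoid.of Gen.c : FreeMonoid (Gen n)) : K n)

/-- The block `h^{[i,j]} = h^i h^{i-1} ⋯ h^{j+1} h^j` (for `j ≤ i`). -/
def block (n i j : ℕ) : K n :=
  (((List.range (i + 1 - j)).map fun t => hK n (i - t))).prod

end Kauffman

namespace Kauffman

variable {n : ℕ}

theorem hK_of_mem {i : ℕ} (h : 1 ≤ i ∧ i ≤ n - 1) :
    hK n i = ((FreeMonoid.of (Gen.h ⟨i, h⟩) : FreeMonoid (Gen n)) : K n) :=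
  dif_pos h

theorem mk_eq_of_rel {x y : FreeMonoid (Gen n)} (h : Rel n x y) : (x : K n) = (y : K n) :=
  (Con.eq _).2 (ConGen.Rel.of _ _ h)

theorem commute_hK {i j : ℕ} (hij : i + 2 ≤ j) : Commute (hK n i) (hK n j) := by
  by_cases hi : 1 ≤ i ∧ i ≤ n - 1
  · by_cases hj : 1 ≤ j ∧ j ≤ n - 1
    · rw [hK_of_mem hi, hK_of_mem hj]
      exact mk_eq_of_rel (Rel.comm ⟨i, hi⟩ ⟨j, hj⟩ (Or.inl hij))
    · rw [hK, hK, dif_neg hj]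
      exact Commute.one_right _
  · rw [hK, dif_neg hi]
    exact Commute.one_left _

theorem hK_mul_hK_mul_hK {i j : ℕ} (hi : 1 ≤ i ∧ i ≤ n - 1) (hj : 1 ≤ j ∧ j ≤ n - 1)
    (hij : j = i + 1 ∨ i = j + 1) : hK n i * hK n j * hK n i = hK n i := by
  rw [hK_of_mem hi, hK_of_mem hj]
  exact mk_eq_of_rel (Rel.absorb ⟨i, hi⟩ ⟨j, hj⟩ hij)

theorem commute_hK_cK (i : ℕ) : Commute (hK n i) (cK n) := by
  by_cases hi : 1 ≤ i ∧ i ≤ n - 1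
  · rw [hK_of_mem hi]
    exact mk_eq_of_rel (Rel.hc ⟨i, hi⟩)
  · rw [hK, dif_neg hi]
    exact Commute.one_left _

theorem hK_mul_self {i : ℕ} (hi : 1 ≤ i ∧ i ≤ n - 1) : hK n i * hK n i = cK n * hK n i := by
  rw [hK_of_mem hi]
  exact mk_eq_of_rel (Rel.hh ⟨i, hi⟩)

theorem block_of_lt {i j : ℕ} (h : i < j) : block n i j = 1 := by
  simp [block, Nat.sub_eq_zero_of_le (show i + 1 ≤ j from h)]

theorem block_self (i : ℕ) : block n i i = hK n i := by
  simp [block]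

theorem block_mul_block {i k j : ℕ} (hj : 1 ≤ j) (hjk : j ≤ k) (hki : k ≤ i + 1) :
    block n i k * block n (k - 1) j = block n i j := by
  have h : i + 1 - j = (i + 1 - k) + (k - 1 + 1 - j) := by omega
  rw [block, block, block, h, List.range_add, List.map_append, List.prod_append, List.map_map]
  congr 3
  funext t
  simp only [Function.comp_apply]
  congr 1
  omega

theorem block_mul_hK {i j : ℕ} (hj : 1 ≤ j) (hji : j ≤ i) :
    block n i (j + 1) * hK n j = block n i j := by
  rw [← block_mul_block hj (by omega : j ≤ j + 1) (by omega : j + 1 ≤ i + 1), Nat.add_sub_cancel,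
    block_self]

theorem hK_mul_block {i j : ℕ} (hj : 1 ≤ j) (hji : j ≤ i) :
    hK n i * block n (i - 1) j = block n i j := by
  rw [← block_self, block_mul_block hj hji (Nat.le_succ i)]

theorem commute_block {i j k l : ℕ} (h : i + 2 ≤ l) :
    Commute (block n i j) (block n k l) := by
  refine Commute.list_prod_left _ _ fun x hx => Commute.list_prod_right _ _ fun y hy => ?_
  simp only [List.mem_map, List.mem_range] at hx hy
  obtain ⟨s, hs, rfl⟩ := hx
  obtain ⟨t, ht, rfl⟩ := hy
  exact commute_hK (by omega)

theorem commute_block_cK (i j : ℕ) : Commute (block n i j) (cK n) := by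
  refine Commute.list_prod_left _ _ fun x hx => ?_
  simp only [List.mem_map] at hx
  obtain ⟨s, -, rfl⟩ := hx
  exact commute_hK_cK _

/-- Absorption inside a block. -/
theorem block_mul_hK_of_lt {m a i : ℕ} (ha : 1 ≤ a) (hai : a < i) (him : i ≤ m)
    (hm : m ≤ n - 1) : block n m a * hK n i = block n (i - 2) a * block n m i := by
  have hc : Commute (block n (i - 2) a) (hK n i) := by
    rw [← block_self (n := n) i]
    exact commute_block (by omega)
  have hc' : Commute (block n (i - 2) a) (block n m i) := commute_block (by omega)
  have h₁ := hK_mul_block (n := n) (i := i - 1) ha (by omega)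
  rw [show i - 1 - 1 = i - 2 by omega] at h₁
  calc block n m a * hK n i
      = block n m (i + 1) * (hK n i * hK n (i - 1) * hK n i) * block n (i - 2) a := by
        rw [← block_mul_block ha hai.le (by omega : i ≤ m + 1),
          ← block_mul_hK (by omega) him, ← h₁]
        simp only [mul_assoc, hc.eq]
    _ = block n (i - 2) a * block n m i := by
        rw [hK_mul_hK_mul_hK (by omega) (by omega) (by omega), block_mul_hK (by omega) him,
          hc'.eq]

/-- Two consecutive blocks whose lower ends fail to increase can be shortened. -/
theorem block_mul_block_of_le {b a m j : ℕ} (hj : 1 ≤ j) (hja : j ≤ a) (hab : a ≤ b)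
    (hbm : b < m) (hm : m ≤ n - 1) :
    block n b a * block n m j = block n b j * block n m (a + 2) := by
  have hc : Commute (hK n a) (block n m (a + 2)) := by
    rw [← block_self (n := n) a]
    exact commute_block le_rfl
  have hc' : Commute (block n a j) (block n m (a + 2)) := commute_block le_rfl
  calc block n b a * block n m j
      = block n b (a + 1) * block n m (a + 2) * (hK n a * hK n (a + 1) * hK n a)
          * block n (a - 1) j := by
        rw [← block_mul_hK (hj.trans hja) hab,
          ← block_mul_block hj (by omega : j ≤ a + 2) (by omega : a + 2 ≤ m + 1),
          show a + 2 - 1 = a + 1 by omega,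
          ← hK_mul_block (n := n) hj (by omega : j ≤ a + 1), Nat.add_sub_cancel,
          ← hK_mul_block (n := n) hj hja]
        simp only [← mul_assoc]
        rw [mul_assoc (block n b (a + 1)), hc.eq, ← mul_assoc]
    _ = block n b (a + 1) * (block n a j * block n m (a + 2)) := by
        rw [hK_mul_hK_mul_hK (by omega) (by omega) (by omega), mul_assoc _ (hK n a),
          hK_mul_block hj hja, mul_assoc, hc'.eq]
    _ = block n b j * block n m (a + 2) := by
        have := block_mul_block (n := n) hj (by omega : j ≤ a + 1) (by omega : a + 1 ≤ b + 1)
        rw [← mul_assoc, ← this, Nat.add_sub_cancel]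

/-- Products of a power of `c` and blocks with strictly increasing upper ends at most `m`. -/
inductive IsBlockProd (n : ℕ) : ℕ → K n → Prop
  | pow (l : ℕ) : IsBlockProd n 0 (cK n ^ l)
  | skip {m : ℕ} {x : K n} : IsBlockProd n m x → IsBlockProd n (m + 1) x
  | snoc {m a : ℕ} {x : K n} : IsBlockProd n m x → 1 ≤ a → a ≤ m + 1 →
      IsBlockProd n (m + 1) (x * block n (m + 1) a)

theorem IsBlockProd.of_pow (l m : ℕ) : IsBlockProd n m (cK n ^ l) := by
  induction m with
  | zero => exact .pow l
  | succ m ih => exact ih.skip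

theorem IsBlockProd.mul_cK {m : ℕ} {x : K n} (hx : IsBlockProd n m x) :
    IsBlockProd n m (x * cK n) := by
  induction hx with
  | pow l => rw [← pow_succ]; exact .pow _
  | skip _ ih => exact ih.skip
  | snoc _ h₁ h₂ ih =>
    rw [mul_assoc, (commute_block_cK _ _).eq, ← mul_assoc]
    exact ih.snoc h₁ h₂

theorem mul_block_of_forall_mul_hK {P : K n → Prop} {i j : ℕ}
    (h : ∀ x k, j ≤ k → k ≤ i → P x → P (x * hK n k)) {x : K n} (hx : P x) :
    P (x * block n i j) := by
  have key : ∀ L : List ℕ, (∀ k ∈ L, j ≤ k ∧ k ≤ i) → ∀ x, P x →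
      P (x * (L.map (hK n)).prod) := by
    intro L
    induction L with
    | nil => simp
    | cons k L ih =>
      intro hL x hx
      rw [List.map_cons, List.prod_cons, ← mul_assoc]
      have hk := hL k List.mem_cons_self
      exact ih (fun q hq => hL q (List.mem_cons_of_mem _ hq)) _ (h x k hk.1 hk.2 hx)
  have := key ((List.range (i + 1 - j)).map fun t => i - t) (by
    simp only [List.mem_map, List.mem_range]
    rintro k ⟨t, ht, rfl⟩
    omega) x hx
  rwa [List.map_map] at this

theorem IsBlockProd.mul_hK {m : ℕ} (hm : m ≤ n - 1) {x : K n} (hx : IsBlockProd n m x) {i : ℕ}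
    (hi : 1 ≤ i) (him : i ≤ m) : IsBlockProd n m (x * hK n i) := by
  induction m generalizing x i with
  | zero => omega
  | succ m ih =>
    cases hx with
    | skip hx =>
      rcases him.lt_or_eq with h | rfl
      · exact (ih (by omega) hx hi (by omega)).skip
      · rw [← block_self]
        exact hx.snoc hi le_rfl
    | @snoc _ a y hy ha ham =>
      rcases lt_trichotomy i a with h | rfl | h
      · rcases (Nat.succ_le_of_lt h).eq_or_lt with rfl | h
        · rw [mul_assoc, block_mul_hK hi him]
          exact hy.snoc hi him
        · have hc : Commute (hK n i) (block n (m + 1) a) := by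
            rw [← block_self (n := n) i]
            exact commute_block h
          rw [mul_assoc, ← hc.eq, ← mul_assoc]
          exact (ih (by omega) hy hi (by omega)).snoc ha ham
      · rw [← block_mul_hK hi him, mul_assoc, mul_assoc, hK_mul_self ⟨hi, by omega⟩,
          ← (commute_hK_cK i).eq, ← mul_assoc (block _ _ _), block_mul_hK hi him, ← mul_assoc]
        exact (hy.snoc hi him).mul_cK
      · rw [mul_assoc, block_mul_hK_of_lt ha h him hm, ← mul_assoc]
        refine IsBlockProd.snoc ?_ hi him
        exact mul_block_of_forall_mul_hK (P := IsBlockProd n m)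
          (fun x k hk hki hx => ih (by omega) hx (by omega) (by omega)) hy

theorem isBlockProd (x : K n) : IsBlockProd n (n - 1) x := by
  induction x using Con.induction_on with
  | H w =>
    induction w using List.reverseRecOn with
    | nil => exact IsBlockProd.of_pow 0 (n - 1)
    | append_singleton w g ih =>
      cases g with
      | h i =>
        have := ih.mul_hK le_rfl i.2.1 i.2.2
        rwa [hK_of_mem i.2] at this
      | c => exact ih.mul_cK

/-- The product of the blocks with (upper, lower) ends listed in `L`. -/
def blockProd (n : ℕ) (L : List (ℕ × ℕ)) : K n :=
  (L.map fun p => block n p.1 p.2).prod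

theorem blockProd_append (L L' : List (ℕ × ℕ)) :
    blockProd n (L ++ L') = blockProd n L * blockProd n L' := by
  simp [blockProd]

theorem blockProd_cons (p : ℕ × ℕ) (L : List (ℕ × ℕ)) :
    blockProd n (p :: L) = block n p.1 p.2 * blockProd n L := by
  simp [blockProd]

theorem IsBlockProd.exists_list {m : ℕ} {x : K n} (hx : IsBlockProd n m x) :
    ∃ (l : ℕ) (L : List (ℕ × ℕ)), (∀ p ∈ L, 1 ≤ p.2 ∧ p.2 ≤ p.1 ∧ p.1 ≤ m) ∧
      L.Pairwise (fun p q => p.1 < q.1) ∧ x = cK n ^ l * blockProd n L := by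
  induction hx with
  | pow l => exact ⟨l, [], by simp, by simp, by simp [blockProd]⟩
  | skip _ ih =>
    obtain ⟨l, L, h, hL, rfl⟩ := ih
    exact ⟨l, L, fun p hp => by have := h p hp; omega, hL, rfl⟩
  | @snoc m a x _ h₁ h₂ ih =>
    obtain ⟨l, L, h, hL, rfl⟩ := ih
    refine ⟨l, L ++ [(m + 1, a)], ?_, ?_, ?_⟩
    · intro p hp
      rcases List.mem_append.1 hp with hp | hp
      · have := h p hp
        omega
      · rw [List.mem_singleton] at hp
        subst hp
        exact ⟨h₁, h₂, le_rfl⟩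
    · refine List.pairwise_append.2 ⟨hL, List.pairwise_singleton _ _, ?_⟩
      intro p hp q hq
      rw [List.mem_singleton] at hq
      subst hq
      have := h p hp
      simp only
      omega
    · simp [blockProd, mul_assoc]

theorem exists_append_of_not_isChain {α : Type*} {R : α → α → Prop} {L : List α}
    (h : ¬ L.IsChain R) : ∃ L₁ p q L₂, L = L₁ ++ p :: q :: L₂ ∧ ¬ R p q := by
  contrapose! h
  exact List.isChain_iff_forall_rel_of_append_cons_cons.2 fun {p q L₁ L₂} hL => h L₁ p q L₂ hL

/-- Lower ends can be made strictly increasing, keeping the upper ends so. -/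
theorem exists_blockProd_eq (L : List (ℕ × ℕ))
    (h : ∀ p ∈ L, 1 ≤ p.2 ∧ p.2 ≤ p.1 ∧ p.1 ≤ n - 1) (hL : L.Pairwise fun p q => p.1 < q.1) :
    ∃ L' : List (ℕ × ℕ), (∀ p ∈ L', 1 ≤ p.2 ∧ p.2 ≤ p.1 ∧ p.1 ≤ n - 1) ∧
      L'.Pairwise (fun p q => p.1 < q.1) ∧ L'.Pairwise (fun p q => p.2 < q.2) ∧
      blockProd n L = blockProd n L' := by
  by_cases hc : L.IsChain fun p q => p.2 < q.2
  · have : IsTrans (ℕ × ℕ) fun p q => p.2 < q.2 := ⟨fun _ _ _ => lt_trans⟩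
    exact ⟨L, h, hL, List.isChain_iff_pairwise.1 hc, rfl⟩
  · obtain ⟨L₁, ⟨b, a⟩, ⟨m, j⟩, L₂, rfl, hpq⟩ := exists_append_of_not_isChain hc
    have hba := h (b, a) (by simp)
    have hmj := h (m, j) (by simp)
    have hbm : b < m := by
      have := (List.pairwise_append.1 hL).2.1
      exact List.rel_of_pairwise_cons this (List.mem_cons_self)
    simp only at hba hmj hpq
    have key := block_mul_block_of_le (n := n) hmj.1 (not_lt.1 hpq) hba.2.1 hbm hmj.2.2
    by_cases hm : a + 2 ≤ m
    · obtain ⟨L', h', hb, ha, e⟩ := exists_blockProd_eq (L₁ ++ (b, j) :: (m, a + 2) :: L₂)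
        (by
          intro p hp
          simp only [List.mem_append, List.mem_cons] at hp h
          rcases hp with hp | rfl | rfl | hp
          · exact h p (Or.inl hp)
          · simp only; omega
          · simp only; omega
          · exact h p (by simp [hp]))
        (by simpa [List.pairwise_append] using hL)
      refine ⟨L', h', hb, ha, e ▸ ?_⟩
      simp only [blockProd_append, blockProd_cons]
      rw [← mul_assoc (block n b a), key, mul_assoc (block n b j)]
    · obtain ⟨L', h', hb, ha, e⟩ := exists_blockProd_eq (L₁ ++ (b, j) :: L₂)
        (by
          intro p hp
          simp only [List.mem_append, List.mem_cons] at hp h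
          rcases hp with hp | rfl | hp
          · exact h p (Or.inl hp)
          · simp only; omega
          · exact h p (by simp [hp]))
        (by
          have hL' : (L₁ ++ (b, j) :: (m, j) :: L₂).Pairwise fun p q => p.1 < q.1 := by
            simpa [List.pairwise_append] using hL
          exact hL'.sublist
            (((List.sublist_cons_self (m, j) L₂).cons_cons (b, j)).append_left L₁))
      refine ⟨L', h', hb, ha, e ▸ ?_⟩
      simp only [blockProd_append, blockProd_cons]
      rw [← mul_assoc (block n b a), key, block_of_lt (by omega : m < a + 2), mul_one]
termination_by (L.map fun p => p.1 + 1 - p.2).sum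
decreasing_by
  all_goals
    subst_vars
    simp only [List.map_append, List.map_cons, List.sum_append, List.sum_cons]
    omega

end Kauffman

open Kauffman in
/-- Every element of the Kauffman monoid `K n` equals some
`c^l h^{[b_1,a_1]} ⋯ h^{[b_k,a_k]}` with `1 ≤ a_t ≤ b_t ≤ n-1`,
`a_1 < … < a_k` and `b_1 < … < b_k` (the case `l = k = 0` giving `1`). -/
theorem kauffman_jones_normal_form_exists (n : ℕ) (hn : 2 ≤ n) (x : K n) :
    ∃ (l k : ℕ) (a b : Fin k → ℕ),
      (∀ t, 1 ≤ a t ∧ a t ≤ b t ∧ b t ≤ n - 1) ∧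
      StrictMono a ∧ StrictMono b ∧
      x = (cK n) ^ l * (List.ofFn fun t => block n (b t) (a t)).prod := by
  obtain ⟨l, L, h, hL, rfl⟩ := (isBlockProd x).exists_list
  obtain ⟨L', h', hb, ha, e⟩ := exists_blockProd_eq L h hL
  refine ⟨l, L'.length, fun t => (L'.get t).2, fun t => (L'.get t).1,
    fun t => h' _ (L'.get_mem t), fun s t hst => List.pairwise_iff_get.1 ha s t hst,
    fun s t hst => List.pairwise_iff_get.1 hb s t hst, ?_⟩
  rw [e, blockProd]
  congr 2
  conv_lhs => rw [← List.ofFn_get L', List.map_ofFn]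
  rfl
end

section
/- Let n ≥ 2, let k ≥ 1, and let a_1 < … < a_k and b_1 < … < b_k be natural numbers with 1 ≤ a_t ≤ b_t ≤ n−1 for each t. Consider the word w over the alphabet {1, …, n−1} obtained by concatenating the descending runs (b_1, b_1−1, …, a_1), (b_2, b_2−1, …, a_2), …, (b_k, b_k−1, …, a_k) (the word of diapsis indices of the Jones normal form term h^{[b_1,a_1]} ⋯ h^{[b_k,a_k]}). Then for any two positions p < q of w carrying the same letter i, there exist positions strictly between p and q carrying the letter i+1 and carrying the letter i−1. -/
namespace Kauffman

/-- The descending run `(b, b-1, …, a)` of consecutive integers from `b` down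
to `a` (for `a ≤ b`). -/
def run (b a : ℕ) : List ℕ := (List.range (b + 1 - a)).map fun s => b - s

/-- The word of diapsis indices of the Jones normal form term
`h^{[b_1,a_1]} ⋯ h^{[b_k,a_k]}`: the concatenation of the descending runs
`(b_t, b_t - 1, …, a_t)`. -/
def jonesWord (k : ℕ) (a b : Fin k → ℕ) : List ℕ :=
  (List.ofFn fun t => run (b t) (a t)).flatten

end Kauffman

namespace Kauffman

theorem length_run (b a : ℕ) : (run b a).length = b + 1 - a := by
  simp [run]

theorem getElem?_run {b a s : ℕ} (hs : s < b + 1 - a) : (run b a)[s]? = some (b - s) := by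
  simp [run, hs]

end Kauffman

namespace List

variable {α : Type*}

/-- The position in `L.flatten` at which the `t`-th block of `L` starts. -/
def blockStart (L : List (List α)) (t : ℕ) : ℕ := (L.take t).flatten.length

theorem blockStart_succ (L : List (List α)) {t : ℕ} (ht : t < L.length) :
    L.blockStart (t + 1) = L.blockStart t + L[t].length := by
  rw [blockStart, blockStart, List.take_add_one, List.getElem?_eq_getElem ht, Option.toList_some,
    List.flatten_append, List.length_append, List.flatten_singleton]

theorem blockStart_mono (L : List (List α)) : Monotone L.blockStart := fun _ _ hst =>
  ((List.take_prefix_take_left hst).sublist.flatten).length_le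

theorem getElem?_flatten_blockStart_add (L : List (List α)) {t s : ℕ} (ht : t < L.length)
    (hs : s < L[t].length) : L.flatten[L.blockStart t + s]? = L[t][s]? := by
  induction L generalizing t with
  | nil => simp at ht
  | cons x L ih =>
    cases t with
    | zero =>
      simp only [List.getElem_cons_zero] at hs ⊢
      simp [blockStart, List.getElem?_append_left hs]
    | succ t =>
      have h := ih (t := t) (by simpa using ht) (by simpa using hs)
      simpa [blockStart, Nat.add_assoc, List.getElem?_append_right] using h

theorem exists_eq_blockStart_add (L : List (List α)) {p : ℕ} (hp : p < L.flatten.length) :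
    ∃ t, ∃ ht : t < L.length, ∃ s < L[t].length, p = L.blockStart t + s := by
  induction L generalizing p with
  | nil => simp at hp
  | cons x L ih =>
    by_cases hx : p < x.length
    · exact ⟨0, by simp, p, hx, by simp [blockStart]⟩
    · rw [List.flatten_cons, List.length_append] at hp
      obtain ⟨t, ht, s, hs, h⟩ := ih (p := p - x.length) (by omega)
      refine ⟨t + 1, by simpa using ht, s, by simpa using hs, ?_⟩
      simp only [blockStart, List.take_succ_cons, List.flatten_cons, List.length_append] at h ⊢
      omega

end List

namespace Kauffman

variable {k : ℕ} (a b : Fin k → ℕ)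

/-- The position in `jonesWord k a b` at which the `t`-th descending run starts. -/
def runStart (t : ℕ) : ℕ := (List.ofFn fun t => run (b t) (a t)).blockStart t

theorem runStart_add_le {s t : Fin k} (hst : s < t) :
    runStart a b s + (b s + 1 - a s) ≤ runStart a b t := by
  have h := (List.ofFn fun t => run (b t) (a t)).blockStart_succ (t := s) (by simp)
  have h' := (List.ofFn fun t => run (b t) (a t)).blockStart_mono (Nat.succ_le_of_lt hst)
  simp only [List.getElem_ofFn, Fin.eta, length_run] at h
  simp only [runStart]
  exact h ▸ h'

theorem getElem?_jonesWord (t : Fin k) {s : ℕ} (hs : s < b t + 1 - a t) :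
    (jonesWord k a b)[runStart a b t + s]? = some (b t - s) := by
  have h := (List.ofFn fun t => run (b t) (a t)).getElem?_flatten_blockStart_add
    (t := t) (s := s) (by simp) (by simpa [length_run] using hs)
  rw [List.getElem_ofFn, Fin.eta, getElem?_run hs] at h
  exact h

theorem exists_eq_runStart_add {p : ℕ} (hp : p < (jonesWord k a b).length) :
    ∃ t : Fin k, ∃ s < b t + 1 - a t, p = runStart a b t + s := by
  obtain ⟨t, ht, s, hs, h⟩ := List.exists_eq_blockStart_add _ hp
  exact ⟨⟨t, by simpa using ht⟩, s, by simpa [length_run] using hs, h⟩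

end Kauffman

open Kauffman in
/-- In the word of diapsis indices of a Jones normal form term,
between any two positions `p < q` carrying the same letter `i` there are
positions carrying the letter `i+1` and positions carrying the letter `i-1`. -/
theorem jones_word_between_repeats (n k : ℕ) (hn : 2 ≤ n) (hk : 1 ≤ k)
    (a b : Fin k → ℕ)
    (hab : ∀ t, 1 ≤ a t ∧ a t ≤ b t ∧ b t ≤ n - 1)
    (ha : StrictMono a) (hb : StrictMono b)
    (p q : ℕ) (hpq : p < q) (hq : q < (jonesWord k a b).length)
    (hsame : (jonesWord k a b).get ⟨p, lt_trans hpq hq⟩ =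
             (jonesWord k a b).get ⟨q, hq⟩) :
    (∃ r, p < r ∧ r < q ∧ ∃ hr : r < (jonesWord k a b).length,
      (jonesWord k a b).get ⟨r, hr⟩ =
        (jonesWord k a b).get ⟨p, lt_trans hpq hq⟩ + 1) ∧
    (∃ r, p < r ∧ r < q ∧ ∃ hr : r < (jonesWord k a b).length,
      (jonesWord k a b).get ⟨r, hr⟩ =
        (jonesWord k a b).get ⟨p, lt_trans hpq hq⟩ - 1) := by
  simp only [List.get_eq_getElem] at hsame ⊢
  simp only [List.getElem_eq_iff]
  obtain ⟨t, x, hx, hp⟩ := exists_eq_runStart_add a b (hpq.trans hq)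
  obtain ⟨u, y, hy, hqu⟩ := exists_eq_runStart_add a b hq
  have hpv : (jonesWord k a b)[p]'(hpq.trans hq) = b t - x := by
    rw [List.getElem_eq_iff, hp, getElem?_jonesWord a b t hx]
  have hqv : (jonesWord k a b)[q] = b u - y := by
    rw [List.getElem_eq_iff, hqu, getElem?_jonesWord a b u hy]
  have hval : b t - x = b u - y := by
    rw [← hpv, ← hqv, hsame]
  obtain ⟨hat, habt, -⟩ := hab t
  obtain ⟨hau, habu, -⟩ := hab u
  have htu : t < u := by
    rcases lt_trichotomy t u with h | rfl | h
    · exact h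
    · omega
    · have := runStart_add_le a b h
      omega
  have hstart := runStart_add_le a b htu
  have hatu := ha htu
  have hbtu := hb htu
  have hnext := getElem?_jonesWord a b t (s := x + 1) (by omega)
  have hprev := getElem?_jonesWord a b u (s := y - 1) (by omega)
  refine ⟨⟨runStart a b u + (y - 1), by omega, by omega, by omega, ?_⟩,
    ⟨runStart a b t + (x + 1), by omega, by omega, by omega, ?_⟩⟩
  · rw [hprev, hpv]
    congr 1
    omega
  · rw [hnext, hpv]
    congr 1
end

section
/- Fix n ≥ 2 and consider words over the alphabet consisting of the block symbols B(i,j) for 1 ≤ j ≤ i ≤ n−1, the circle symbol c, and the unit symbol 1, with the following reduction rules applied to any two adjacent letters (or single letter) of a word: (i) B(i,j)B(k,l) ⟶ B(k,l)B(i,j) if j ≥ k+2; (ii) B(i,j)B(k,l) ⟶ B(i,l) if i ≥ l and |k−j| = 1; (iii) B(i,j)B(j,l) ⟶ c B(i,l) if l ≤ j; (iv) B(i,j)B(k,l) ⟶ B(k−2,l)B(i,j+2) if j+2 ≤ k, i ≥ k and j ≥ l; (v) B(i,j)B(k,l) ⟶ B(i,l)B(k,j+2) if j+2 ≤ k, i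 < k and j ≥ l; (vi) B(i,j)B(k,l) ⟶ B(k−2,j)B(i,l) if j+2 ≤ k, i ≥ k and j < l; (vii) B(i,j)c ⟶ c B(i,j); (viii) deletion of an occurrence of the symbol 1. Then this reduction relation is strongly normalizing: there is no infinite sequence of reduction steps starting from any word. -/
namespace Kauffman

/-- The alphabet: block symbols `B(i,j)` for `1 ≤ j ≤ i ≤ n-1`, the circle
symbol `c`, and the unit symbol `1`. -/
inductive Sym (n : ℕ) : Type
  | blk (i j : ℕ) (hj : 1 ≤ j) (hji : j ≤ i) (hi : i ≤ n - 1) : Sym n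
  | circ : Sym n
  | one : Sym n

/-- The reduction rules (i)–(viii), acting on contiguous subwords. -/
inductive Rule (n : ℕ) : List (Sym n) → List (Sym n) → Prop
  /-- (i)  `B(i,j)B(k,l) ⟶ B(k,l)B(i,j)` if `j ≥ k+2`. -/
  | swap (i j k l : ℕ) (hj : 1 ≤ j) (hji : j ≤ i) (hi : i ≤ n - 1)
      (hl : 1 ≤ l) (hlk : l ≤ k) (hk : k ≤ n - 1) (h : k + 2 ≤ j) :
      Rule n [Sym.blk i j hj hji hi, Sym.blk k l hl hlk hk]
             [Sym.blk k l hl hlk hk, Sym.blk i j hj hji hi]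
  /-- (ii)  `B(i,j)B(k,l) ⟶ B(i,l)` if `i ≥ l` and `|k-j| = 1`. -/
  | absorb (i j k l : ℕ) (hj : 1 ≤ j) (hji : j ≤ i) (hi : i ≤ n - 1)
      (hl : 1 ≤ l) (hlk : l ≤ k) (hk : k ≤ n - 1)
      (hli : l ≤ i) (h : k = j + 1 ∨ j = k + 1) :
      Rule n [Sym.blk i j hj hji hi, Sym.blk k l hl hlk hk]
             [Sym.blk i l hl hli hi]
  /-- (iii)  `B(i,j)B(j,l) ⟶ c B(i,l)` if `l ≤ j`. -/
  | circle (i j l : ℕ) (hj : 1 ≤ j) (hji : j ≤ i) (hi : i ≤ n - 1)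
      (hl : 1 ≤ l) (hlj : l ≤ j) :
      Rule n [Sym.blk i j hj hji hi, Sym.blk j l hl hlj (le_trans hji hi)]
             [Sym.circ, Sym.blk i l hl (le_trans hlj hji) hi]
  /-- (iv)  `B(i,j)B(k,l) ⟶ B(k-2,l)B(i,j+2)` if `j+2 ≤ k`, `i ≥ k` and `j ≥ l`. -/
  | exch1 (i j k l : ℕ) (hj : 1 ≤ j) (hji : j ≤ i) (hi : i ≤ n - 1)
      (hl : 1 ≤ l) (hlk : l ≤ k) (hk : k ≤ n - 1)
      (h1 : j + 2 ≤ k) (h2 : k ≤ i) (h3 : l ≤ j) :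
      Rule n [Sym.blk i j hj hji hi, Sym.blk k l hl hlk hk]
             [Sym.blk (k - 2) l hl (by omega) (by omega),
              Sym.blk i (j + 2) (by omega) (by omega) hi]
  /-- (v)  `B(i,j)B(k,l) ⟶ B(i,l)B(k,j+2)` if `j+2 ≤ k`, `i < k` and `j ≥ l`. -/
  | exch2 (i j k l : ℕ) (hj : 1 ≤ j) (hji : j ≤ i) (hi : i ≤ n - 1)
      (hl : 1 ≤ l) (hlk : l ≤ k) (hk : k ≤ n - 1)
      (h1 : j + 2 ≤ k) (h2 : i < k) (h3 : l ≤ j) :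
      Rule n [Sym.blk i j hj hji hi, Sym.blk k l hl hlk hk]
             [Sym.blk i l hl (by omega) hi,
              Sym.blk k (j + 2) (by omega) h1 hk]
  /-- (vi)  `B(i,j)B(k,l) ⟶ B(k-2,j)B(i,l)` if `j+2 ≤ k`, `i ≥ k` and `j < l`. -/
  | exch3 (i j k l : ℕ) (hj : 1 ≤ j) (hji : j ≤ i) (hi : i ≤ n - 1)
      (hl : 1 ≤ l) (hlk : l ≤ k) (hk : k ≤ n - 1)
      (h1 : j + 2 ≤ k) (h2 : k ≤ i) (h3 : j < l) :
      Rule n [Sym.blk i j hj hji hi, Sym.blk k l hl hlk hk]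
             [Sym.blk (k - 2) j hj (by omega) (by omega),
              Sym.blk i l hl (by omega) hi]
  /-- (vii)  `B(i,j)c ⟶ c B(i,j)`. -/
  | circSwap (i j : ℕ) (hj : 1 ≤ j) (hji : j ≤ i) (hi : i ≤ n - 1) :
      Rule n [Sym.blk i j hj hji hi, Sym.circ]
             [Sym.circ, Sym.blk i j hj hji hi]
  /-- (viii)  deletion of an occurrence of the unit symbol `1`. -/
  | unit : Rule n [Sym.one] []

/-- One reduction step: replace an occurrence of a left-hand side pattern (as a
contiguous subword) by the corresponding right-hand side. -/
def Step (n : ℕ) (w w' : List (Sym n)) : Prop :=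
  ∃ u v a b, Rule n a b ∧ w = u ++ a ++ v ∧ w' = u ++ b ++ v

end Kauffman

namespace Kauffman

/-- The number of letters other than the circle symbol. -/
def nonCircCount {n : ℕ} : List (Sym n) → ℕ
  | [] => 0
  | Sym.blk _ _ _ _ _ :: w => nonCircCount w + 1
  | Sym.circ :: w => nonCircCount w
  | Sym.one :: w => nonCircCount w + 1

/-- The upper indices of the blocks, read as the digits of a number in base `n`. -/
def topValue {n : ℕ} : List (Sym n) → ℕ
  | [] => 0
  | Sym.blk i _ _ _ _ :: w => i * n ^ nonCircCount w + topValue w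
  | Sym.circ :: w => topValue w
  | Sym.one :: w => topValue w

/-- The sum of `n - j` over the lower indices `j` of the blocks. -/
def bottomDefect {n : ℕ} : List (Sym n) → ℕ
  | [] => 0
  | Sym.blk _ j _ _ _ :: w => (n - j) + bottomDefect w
  | Sym.circ :: w => bottomDefect w
  | Sym.one :: w => bottomDefect w

/-- A weight in which each circle counts `2 ^ b`, with `b` the number of blocks to its left. -/
def circWeight {n : ℕ} : List (Sym n) → ℕ
  | [] => 0
  | Sym.blk _ _ _ _ _ :: w => 2 * circWeight w
  | Sym.circ :: w => circWeight w + 1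
  | Sym.one :: w => circWeight w

/-- The termination measure, to be compared lexicographically. -/
def wordMeasure {n : ℕ} (w : List (Sym n)) : ℕ ×ₗ ℕ ×ₗ ℕ ×ₗ ℕ :=
  toLex (nonCircCount w, toLex (topValue w, toLex (bottomDefect w, circWeight w)))

theorem wordMeasure_lt_iff {n : ℕ} {w w' : List (Sym n)} :
    wordMeasure w' < wordMeasure w ↔
      nonCircCount w' < nonCircCount w ∨ nonCircCount w' = nonCircCount w ∧
        (topValue w' < topValue w ∨ topValue w' = topValue w ∧
          (bottomDefect w' < bottomDefect w ∨ bottomDefect w' = bottomDefect w ∧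
            circWeight w' < circWeight w)) := by
  simp [wordMeasure, Prod.Lex.toLex_lt_toLex]

theorem wordMeasure_cons_lt {n : ℕ} (s : Sym n) {w w' : List (Sym n)}
    (h : wordMeasure w' < wordMeasure w) : wordMeasure (s :: w') < wordMeasure (s :: w) := by
  rw [wordMeasure_lt_iff] at h ⊢
  rcases h with h | ⟨hc, h⟩
  · left
    cases s <;> simpa [nonCircCount] using h
  · cases s <;> simp [nonCircCount, topValue, bottomDefect, circWeight, hc] <;> omega

theorem wordMeasure_append_lt {n : ℕ} (u : List (Sym n)) {w w' : List (Sym n)}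
    (h : wordMeasure w' < wordMeasure w) : wordMeasure (u ++ w') < wordMeasure (u ++ w) := by
  induction u with
  | nil => exact h
  | cons s u ih => exact wordMeasure_cons_lt s ih

/-- Replacing the two leading digits `i, k` by `a, i` with `a < i` lowers a base `n` value. -/
theorem leading_digits_lt {n a i k : ℕ} (hi : i < n) (ha : a < i) (c t : ℕ) :
    a * n ^ (c + 1) + (i * n ^ c + t) < i * n ^ (c + 1) + (k * n ^ c + t) := by
  have hpos : 0 < n ^ c := Nat.pow_pos (by omega)
  have hdigits : a * n + i < i * n + k := by
    obtain ⟨d, rfl⟩ := Nat.exists_eq_add_of_lt ha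
    nlinarith
  have := Nat.mul_lt_mul_of_pos_right hdigits hpos
  rw [pow_succ]
  nlinarith

theorem Rule.wordMeasure_lt {n : ℕ} {a b : List (Sym n)} (h : Rule n a b) (v : List (Sym n)) :
    wordMeasure (b ++ v) < wordMeasure (a ++ v) := by
  rw [wordMeasure_lt_iff]
  cases h <;> simp only [List.cons_append, List.nil_append, nonCircCount]
  case absorb => omega
  case circle => omega
  case unit => omega
  case circSwap =>
    simp [topValue, bottomDefect, circWeight, nonCircCount]
    omega
  case exch2 =>
    simp [topValue, bottomDefect, nonCircCount]
    omega
  all_goals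
    refine Or.inr ⟨trivial, Or.inl ?_⟩
    simp only [topValue, nonCircCount]
    exact leading_digits_lt (by omega) (by omega) _ _

theorem Step.wordMeasure_lt {n : ℕ} {w w' : List (Sym n)} (h : Step n w w') :
    wordMeasure w' < wordMeasure w := by
  obtain ⟨u, v, a, b, hab, rfl, rfl⟩ := h
  simpa only [List.append_assoc] using wordMeasure_append_lt u (hab.wordMeasure_lt v)

end Kauffman

open Kauffman in
/-- The reduction relation on words over the block/circle/unit
alphabet is strongly normalizing: the converse of the one-step reduction
relation is well-founded, so there is no infinite reduction sequence. -/
theorem kauffman_reduction_strongly_normalizing (n : ℕ) (hn : 2 ≤ n) :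
    WellFounded (fun w' w : List (Sym n) => Step n w w') := by
  exact Subrelation.wf (fun h => Step.wordMeasure_lt h) (InvImage.wf wordMeasure wellFounded_lt)
end
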